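/- arXiv:2302.05909 — 2 statements merged into one kernel-verified Lean document; each statement's English description precedes it below -/
import Mathlib

section
/- Any single-generated involutive two-valued group is isomorphic to a coset two-valued group of the form C/ι_a, where C is a cyclic group and ι_a : C → C is the antipodal involution ι_a(c) = c⁻¹. In particular, every single-generated involutive two-valued group is commutative. -/
/-!
Two-valued groups after V.M. Buchstaber, A.P. Veselov and A.A. Gaifullin.

`X.mul x y` is the two-element multiset `x * y`.
-/

universe u v w u' v' w'

/-- A two-valued group: a set with a multiplication valued in two-element multisets,
a strong identity `e`, and a (unique) inverse. -/
structure TwoValuedGroup (T : Type u) where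
  mul : T → T → Multiset T
  e : T
  inv : T → T
  card_mul : ∀ x y, Multiset.card (mul x y) = 2
  assoc : ∀ x y z, (mul x y).bind (fun t => mul t z) = (mul y z).bind (fun t => mul x t)
  e_mul : ∀ x, mul e x = {x, x}
  mul_e : ∀ x, mul x e = {x, x}
  e_mem_mul_inv : ∀ x, e ∈ mul x (inv x)
  e_mem_inv_mul : ∀ x, e ∈ mul (inv x) x
  inv_unique : ∀ x y, (e ∈ mul x y ∨ e ∈ mul y x) → y = inv x

namespace TwoValuedGroup

/-- Commutativity of a two-valued group. -/
def Commutative {T : Type u} (X : TwoValuedGroup T) : Prop := ∀ x y, X.mul x y = X.mul y x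

/-- Involutivity: every element is its own inverse. -/
def Involutive {T : Type u} (X : TwoValuedGroup T) : Prop := ∀ x, X.inv x = x

/-- A homomorphism of two-valued groups. -/
def IsHom {T : Type u} {S : Type v} (X : TwoValuedGroup T) (Z : TwoValuedGroup S)
    (f : T → S) : Prop :=
  f X.e = Z.e ∧ ∀ x y, (X.mul x y).map f = Z.mul (f x) (f y)

/-- Two two-valued groups are isomorphic if there is a bijective homomorphism. -/
def Isomorphic {T : Type u} {S : Type v} (X : TwoValuedGroup T) (Z : TwoValuedGroup S) : Prop :=
  ∃ f : T → S, Function.Bijective f ∧ IsHom X Z f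

/-- A subgroup of a two-valued group: a subset closed under multiplication. -/
def IsSubgroup {T : Type u} (X : TwoValuedGroup T) (Y : Set T) : Prop :=
  ∀ y₁ ∈ Y, ∀ y₂ ∈ Y, ∀ z ∈ X.mul y₁ y₂, z ∈ Y

/-- `S` generates `X` if the only subgroup of `X` containing `S` is all of `X`. -/
def Generates {T : Type u} (X : TwoValuedGroup T) (S : Set T) : Prop :=
  ∀ Y : Set T, X.IsSubgroup Y → S ⊆ Y → Y = Set.univ

/-- Finitely generated two-valued group. -/
def FinitelyGenerated {T : Type u} (X : TwoValuedGroup T) : Prop :=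
  ∃ S : Set T, S.Finite ∧ X.Generates S

/-- A family of integer power sequences: `P x k` is the `k`-th power `x^k` of `x`;
these are uniquely determined in an involutive two-valued group. -/
def IsPowFamily {T : Type u} (X : TwoValuedGroup T) (P : T → ℤ → T) : Prop :=
  ∀ x : T, P x 0 = X.e ∧ P x 1 = x ∧ (∀ k : ℤ, P x (-k) = P x k) ∧
    ∀ k : ℤ, 1 ≤ k → X.mul x (P x k) = {P x (k - 1), P x (k + 1)}

/-- The order of an element: the least positive `k` with `x^k = e`;
the value `0` encodes infinite order. -/
noncomputable def ordOf {T : Type u} (X : TwoValuedGroup T) (P : T → ℤ → T) (x : T) : ℕ :=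
  sInf {n : ℕ | 0 < n ∧ P x (n : ℤ) = X.e}

/-- `ord x > 2` (where infinite order counts as `> 2`). -/
def OrdGT2 {T : Type u} (X : TwoValuedGroup T) (P : T → ℤ → T) (x : T) : Prop :=
  X.ordOf P x = 0 ∨ 2 < X.ordOf P x

/-- A two-valued group is special if it contains a special pair: `ord x > 2`, `ord y > 2`,
and `x * y` consists of two equal elements. -/
def IsSpecial {T : Type u} (X : TwoValuedGroup T) (P : T → ℤ → T) : Prop :=
  ∃ x y z : T, X.OrdGT2 P x ∧ X.OrdGT2 P y ∧ X.mul x y = {z, z}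

/-- `ι` is an involutive automorphism of the group `G`. -/
def IsInvolutiveAut (G : Type v) [Group G] (ι : G → G) : Prop :=
  Function.Bijective ι ∧ (∀ g h : G, ι (g * h) = ι g * ι h) ∧ (∀ g : G, ι (ι g) = g)

/-- `X` is isomorphic to the coset two-valued group `G/ι`: there is a quotient map
`π : G → X` whose fibres are exactly the `ι`-orbits and which carries the coset
two-valued multiplication `π g * π h = [π (g h), π (g ι(h))]`. -/
def IsCosetOf {T : Type u} {G : Type v} [Group G] (X : TwoValuedGroup T) (ι : G → G) : Prop :=
  ∃ π : G → T, Function.Surjective π ∧ π 1 = X.e ∧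
    (∀ g, π (ι g) = π g) ∧
    (∀ g h, π g = π h → h = g ∨ h = ι g) ∧
    (∀ g h, X.mul (π g) (π h) = {π (g * h), π (g * ι h)}) ∧
    (∀ g, X.inv (π g) = π g⁻¹)

/-- `X` is isomorphic to the coset two-valued group `X^a_A = A/ι_a`
for the antipodal involution `ι_a (a) = a⁻¹` of the abelian group `A`. -/
def IsAntipodalCosetOf {T : Type u} (X : TwoValuedGroup T) (A : Type v) [CommGroup A] : Prop :=
  ∃ π : A → T, Function.Surjective π ∧ π 1 = X.e ∧
    (∀ a, π a⁻¹ = π a) ∧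
    (∀ a b, π a = π b → b = a ∨ b = a⁻¹) ∧
    (∀ a b, X.mul (π a) (π b) = {π (a * b), π (a * b⁻¹)}) ∧
    (∀ a, X.inv (π a) = π a⁻¹)

/-- A Boolean group: every element squares to the identity. -/
def IsBooleanGroup (V : Type v) [CommGroup V] : Prop := ∀ x : V, x * x = 1

/-- For a Boolean group, `dim V ≥ 2` (as an `𝔽₂`-vector space) is equivalent to the
existence of two distinct nontrivial elements. -/
def BoolDimGE2 (V : Type v) [CommGroup V] : Prop := ∃ a b : V, a ≠ 1 ∧ b ≠ 1 ∧ a ≠ b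

/-- For a Boolean group, `dim V ≥ 3` is equivalent to the existence of three
linearly independent elements. -/
def BoolDimGE3 (V : Type v) [CommGroup V] : Prop :=
  ∃ a b c : V, a ≠ 1 ∧ b ≠ 1 ∧ a ≠ b ∧ c ≠ 1 ∧ c ≠ a ∧ c ≠ b ∧ c ≠ a * b

/-- Isomorphism of (single-valued) groups. -/
def GroupIsomorphic (A : Type v) (B : Type w) [CommGroup A] [CommGroup B] : Prop :=
  Nonempty (A ≃* B)

/-- `X` is isomorphic to the coset two-valued group `X^u_V = (V × V)/ι_u`,
where `ι_u (a, b) = (a, a b)` is the unipotent involution of the Boolean group `V × V`. -/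
def IsUnipotentCosetOf {T : Type u} (X : TwoValuedGroup T) (V : Type v) [CommGroup V] : Prop :=
  ∃ π : V × V → T, Function.Surjective π ∧ π (1, 1) = X.e ∧
    (∀ a b : V, π (a, a * b) = π (a, b)) ∧
    (∀ p q : V × V, π p = π q → q = p ∨ q = (p.1, p.1 * p.2)) ∧
    (∀ a₁ b₁ a₂ b₂ : V,
      X.mul (π (a₁, b₁)) (π (a₂, b₂)) = {π (a₁ * a₂, b₁ * b₂), π (a₁ * a₂, a₂ * b₁ * b₂)}) ∧
    (∀ p : V × V, X.inv (π p) = π p)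

/-- `X` is isomorphic to the direct product `X^u_V × W` of the unipotent coset
two-valued group `X^u_V = (V × V)/ι_u` and the Boolean group `W`. -/
def IsUnipotentCosetProdOf {T : Type u} (X : TwoValuedGroup T) (V : Type v) (W : Type w)
    [CommGroup V] [CommGroup W] : Prop :=
  ∃ f : (V × V) × W → T, Function.Surjective f ∧ f ((1, 1), 1) = X.e ∧
    (∀ (a b : V) (w : W), f ((a, a * b), w) = f ((a, b), w)) ∧
    (∀ p q : (V × V) × W, f p = f q → q.2 = p.2 ∧ (q.1 = p.1 ∨ q.1 = (p.1.1, p.1.1 * p.1.2))) ∧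
    (∀ (a₁ b₁ a₂ b₂ : V) (w₁ w₂ : W),
      X.mul (f ((a₁, b₁), w₁)) (f ((a₂, b₂), w₂)) =
        {f ((a₁ * a₂, b₁ * b₂), w₁ * w₂), f ((a₁ * a₂, a₂ * b₁ * b₂), w₁ * w₂)}) ∧
    (∀ p, X.inv (f p) = f p)

open Classical in
/-- The multiplication table of the special two-valued group `Y_V` on `Option V`:
`none` is the extra element `s`, `some v` are the elements of the Boolean group `V`. -/
noncomputable def mulY {V : Type v} [CommGroup V] : Option V → Option V → Multiset (Option V)
  | some x, some y =>
      if x = y then (if x = 1 then {some 1, some 1} else {some 1, none})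
      else {some (x * y), some (x * y)}
  | some x, none => if x = 1 then {none, none} else {some x, some x}
  | none, some y => if y = 1 then {none, none} else {some y, some y}
  | none, none => {some 1, some 1}

/-- `X` is isomorphic to the special two-valued group `Y_V`. -/
def IsYOf {T : Type u} (X : TwoValuedGroup T) (V : Type v) [CommGroup V] : Prop :=
  ∃ f : Option V → T, Function.Bijective f ∧ f (some 1) = X.e ∧
    (∀ uu vv : Option V, X.mul (f uu) (f vv) = (mulY uu vv).map f) ∧
    (∀ uu : Option V, X.inv (f uu) = f uu)

/-- `X` is isomorphic to the direct product `Y_V × W`. -/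
def IsYProdOf {T : Type u} (X : TwoValuedGroup T) (V : Type v) (W : Type w)
    [CommGroup V] [CommGroup W] : Prop :=
  ∃ f : Option V × W → T, Function.Bijective f ∧ f (some 1, 1) = X.e ∧
    (∀ (uu vv : Option V) (w₁ w₂ : W),
      X.mul (f (uu, w₁)) (f (vv, w₂)) = (mulY uu vv).map (fun z => f (z, w₁ * w₂))) ∧
    (∀ p : Option V × W, X.inv (f p) = f p)

/-- `X` is isomorphic to the direct product `X' × W` of the two-valued group `X'`
and the (single-valued) Boolean group `W`. -/
def IsDirectProdOf {T : Type u} {T' : Type v} (W : Type w) [CommGroup W]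
    (X : TwoValuedGroup T) (X' : TwoValuedGroup T') : Prop :=
  ∃ f : T' × W → T, Function.Bijective f ∧ f (X'.e, 1) = X.e ∧
    (∀ (x₁ x₂ : T') (w₁ w₂ : W),
      X.mul (f (x₁, w₁)) (f (x₂, w₂)) = (X'.mul x₁ x₂).map (fun z => f (z, w₁ * w₂))) ∧
    (∀ (x : T') (w : W), X.inv (f (x, w)) = f (X'.inv x, w))

/-- `X` contains a single-valued direct factor: `X ≅ X' × W` with `W` a nontrivial
Boolean group. -/
def HasSingleValuedDirectFactor {T : Type u} (X : TwoValuedGroup T) : Prop :=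
  ∃ (T' : Type u) (X' : TwoValuedGroup T') (W : Type u) (iW : CommGroup W),
    X'.Commutative ∧ X'.Involutive ∧ @IsBooleanGroup W iW ∧ Nontrivial W ∧
    @IsDirectProdOf T T' W iW X X'

/-- The Boolean group `C₂ⁿ`. -/
abbrev C2vec (n : ℕ) : Type := Fin n → Multiplicative (ZMod 2)

/-- The group `C₄ⁿ`. -/
abbrev C4vec (n : ℕ) : Type := Fin n → Multiplicative (ZMod 4)

end TwoValuedGroup

namespace TwoValuedGroup

/-- A cyclic group: generated by a single element. -/
def IsCyclicGroup (C : Type v) [Group C] : Prop :=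
  ∃ g : C, ∀ x : C, x ∈ Subgroup.zpowers g

section Involutive

variable {T : Type u} {X : TwoValuedGroup T}

lemma exists_mul_eq_of_mem {a x y : T} (h : a ∈ X.mul x y) : ∃ c, X.mul x y = {a, c} := by
  obtain ⟨t, ht⟩ := Multiset.exists_cons_of_mem h
  have hc := X.card_mul x y
  rw [ht, Multiset.card_cons] at hc
  obtain ⟨c, rfl⟩ := Multiset.card_eq_one.1 (Nat.succ.inj hc)
  exact ⟨c, ht⟩

lemma Involutive.e_mem_mul_iff (hinv : X.Involutive) {a b : T} : X.e ∈ X.mul a b ↔ a = b := by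
  constructor
  · intro h
    rw [X.inv_unique a b (Or.inl h), hinv]
  · rintro rfl
    simpa only [hinv a] using X.e_mem_mul_inv a

/-- Membership in a product is invariant under cyclic rotation of the three elements. -/
lemma Involutive.mem_mul_rotate (hinv : X.Involutive) {x y z : T} (h : z ∈ X.mul x y) :
    y ∈ X.mul z x := by
  have he : X.e ∈ (X.mul x y).bind (fun t => X.mul z t) :=
    Multiset.mem_bind.2 ⟨z, h, hinv.e_mem_mul_iff.2 rfl⟩
  rw [← X.assoc z x y, Multiset.mem_bind] at he
  obtain ⟨t, ht, hte⟩ := he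
  rwa [hinv.e_mem_mul_iff.1 hte] at ht

/-- If `x` commutes with `y` and with one of the two elements of `x * y`, then it commutes with
the other one. -/
lemma mul_comm_of_mul_eq {x y a b : T} (hxy : X.mul x y = X.mul y x) (h : X.mul x y = {a, b})
    (ha : X.mul x a = X.mul a x) : X.mul x b = X.mul b x := by
  have hassoc := X.assoc x y x
  rw [← hxy, h] at hassoc
  simp only [Multiset.insert_eq_cons, Multiset.cons_bind, Multiset.singleton_bind] at hassoc
  rw [ha] at hassoc
  exact (add_left_cancel hassoc).symm

open Classical in
/-- The element paired with `a` in the product `x * y`, when `a ∈ x * y`. -/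
noncomputable def partner (X : TwoValuedGroup T) (x y a : T) : T :=
  if h : ∃ c, X.mul x y = {a, c} then h.choose else a

lemma mul_eq_partner {x y a : T} (h : a ∈ X.mul x y) : X.mul x y = {a, X.partner x y a} := by
  have h' := exists_mul_eq_of_mem h
  rw [partner, dif_pos h']
  exact h'.choose_spec

/-- Natural powers of `x`, determined by `x * x ^ (n + 1) = [x ^ n, x ^ (n + 2)]`. -/
noncomputable def natPow (X : TwoValuedGroup T) (x : T) : ℕ → T
  | 0 => X.e
  | 1 => x
  | n + 2 => X.partner x (X.natPow x (n + 1)) (X.natPow x n)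

lemma Involutive.natPow_spec (hinv : X.Involutive) (x : T) (n : ℕ) :
    X.mul x (X.natPow x (n + 1)) = {X.natPow x n, X.natPow x (n + 2)} ∧
      X.mul x (X.natPow x n) = X.mul (X.natPow x n) x ∧
      X.mul x (X.natPow x (n + 1)) = X.mul (X.natPow x (n + 1)) x := by
  induction n with
  | zero =>
    refine ⟨mul_eq_partner ?_, ?_, rfl⟩
    · exact hinv.e_mem_mul_iff.2 rfl
    · simp only [natPow, X.e_mul, X.mul_e]
  | succ n ih =>
    obtain ⟨hmul, hn, hn'⟩ := ih
    have hcomm := mul_comm_of_mul_eq hn' hmul hn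
    refine ⟨mul_eq_partner ?_, hn', hcomm⟩
    rw [hcomm]
    refine hinv.mem_mul_rotate ?_
    rw [hmul]
    simp

/-- Integer powers of `x`, extended evenly from the natural ones. -/
noncomputable def intPow (X : TwoValuedGroup T) (x : T) (k : ℤ) : T := X.natPow x k.natAbs

@[simp]
lemma intPow_zero (x : T) : X.intPow x 0 = X.e := rfl

@[simp]
lemma intPow_one (x : T) : X.intPow x 1 = x := rfl

@[simp]
lemma intPow_neg (x : T) (k : ℤ) : X.intPow x (-k) = X.intPow x k := by
  simp [intPow]

lemma intPow_sub_comm (x : T) (m n : ℤ) : X.intPow x (m - n) = X.intPow x (n - m) := by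
  rw [← intPow_neg, neg_sub]

lemma Involutive.mul_intPow (hinv : X.Involutive) (x : T) (k : ℤ) :
    X.mul x (X.intPow x k) = {X.intPow x (k - 1), X.intPow x (k + 1)} := by
  have hnat (n : ℕ) : X.mul x (X.intPow x n) = {X.intPow x (n - 1), X.intPow x (n + 1)} := by
    cases n with
    | zero => simp [X.mul_e]
    | succ n =>
      have h := (hinv.natPow_spec x n).1
      have h₁ : ((n + 1 : ℕ) : ℤ) - 1 = (n : ℕ) := by simp
      have h₂ : ((n + 1 : ℕ) : ℤ) + 1 = (n + 2 : ℕ) := by push_cast; ring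
      rw [h₁, h₂]
      exact h
  obtain ⟨n, rfl | rfl⟩ := k.eq_nat_or_neg
  · exact hnat n
  · have h₁ : -(n : ℤ) - 1 = -(n + 1) := by ring
    have h₂ : -(n : ℤ) + 1 = -(n - 1) := by ring
    rw [h₁, h₂, intPow_neg, intPow_neg, intPow_neg, hnat, Multiset.pair_comm]

lemma Involutive.intPow_mul_intPow (hinv : X.Involutive) (x : T) (m n : ℤ) :
    X.mul (X.intPow x m) (X.intPow x n) = {X.intPow x (m + n), X.intPow x (m - n)} := by
  have hnat (m : ℕ) : ∀ n : ℤ,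
      X.mul (X.intPow x m) (X.intPow x n) = {X.intPow x (m + n), X.intPow x (m - n)} := by
    induction m using Nat.twoStepInduction with
    | zero => intro n; simp [X.e_mul]
    | one =>
      intro n
      rw [Nat.cast_one, intPow_one, hinv.mul_intPow, intPow_sub_comm, add_comm,
        Multiset.pair_comm]
    | more m ih ih' =>
      intro n
      have hassoc := X.assoc x (X.intPow x (m + 1 : ℕ)) (X.intPow x n)
      rw [hinv.mul_intPow, ih'] at hassoc
      simp only [Multiset.insert_eq_cons, Multiset.cons_bind, Multiset.singleton_bind] at hassoc
      have h₁ : ((m + 1 : ℕ) : ℤ) - 1 = (m : ℕ) := by simp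
      have h₂ : ((m + 1 : ℕ) : ℤ) + 1 = (m + 2 : ℕ) := by push_cast; ring
      have h₃ : ((m + 1 : ℕ) : ℤ) + n - 1 = m + n := by push_cast; ring
      have h₄ : ((m + 1 : ℕ) : ℤ) + n + 1 = (m + 2 : ℕ) + n := by push_cast; ring
      have h₅ : ((m + 1 : ℕ) : ℤ) - n - 1 = m - n := by push_cast; ring
      have h₆ : ((m + 1 : ℕ) : ℤ) - n + 1 = (m + 2 : ℕ) - n := by push_cast; ring
      rw [h₁, h₂, ih n, hinv.mul_intPow, hinv.mul_intPow, h₃, h₄, h₅, h₆] at hassoc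
      simp only [Multiset.insert_eq_cons, ← Multiset.singleton_add] at hassoc ⊢
      rw [add_add_add_comm] at hassoc
      exact add_left_cancel hassoc
  obtain ⟨k, rfl | rfl⟩ := m.eq_nat_or_neg
  · exact hnat k n
  · have h₁ : -(k : ℤ) + n = -(k - n) := by ring
    have h₂ : -(k : ℤ) - n = -(k + n) := by ring
    rw [h₁, h₂, intPow_neg, intPow_neg, intPow_neg, hnat, Multiset.pair_comm]

lemma Involutive.intPow_eq_intPow_iff (hinv : X.Involutive) (x : T) (m n : ℤ) :
    X.intPow x m = X.intPow x n ↔ X.intPow x (m + n) = X.e ∨ X.intPow x (m - n) = X.e := by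
  rw [← hinv.e_mem_mul_iff, hinv.intPow_mul_intPow]
  simp [eq_comm]

/-- The subgroup of exponents `k` with `x ^ k = e`. -/
def Involutive.exponents (hinv : X.Involutive) (x : T) : AddSubgroup ℤ where
  carrier := {k | X.intPow x k = X.e}
  zero_mem' := intPow_zero x
  add_mem' {a b} ha hb := by
    rw [Set.mem_ofPred_eq] at ha hb ⊢
    have h : X.intPow x (a + b) ∈ X.mul (X.intPow x a) (X.intPow x b) := by
      rw [hinv.intPow_mul_intPow]
      simp
    rw [ha, hb, X.e_mul] at h
    simpa using h
  neg_mem' {a} ha := by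
    rw [Set.mem_ofPred_eq] at ha ⊢
    rwa [intPow_neg]

lemma Involutive.mem_exponents (hinv : X.Involutive) {x : T} {k : ℤ} :
    k ∈ hinv.exponents x ↔ X.intPow x k = X.e := Iff.rfl

lemma Involutive.intPow_surjective (hinv : X.Involutive) {x : T} (hx : X.Generates {x}) :
    Function.Surjective (X.intPow x) := by
  rw [← Set.range_eq_univ]
  refine hx _ ?_ (Set.singleton_subset_iff.2 ⟨1, intPow_one x⟩)
  rintro _ ⟨m, rfl⟩ _ ⟨n, rfl⟩ z hz
  rw [hinv.intPow_mul_intPow] at hz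
  simp only [Multiset.insert_eq_cons, Multiset.mem_cons, Multiset.mem_singleton] at hz
  rcases hz with rfl | rfl
  exacts [⟨_, rfl⟩, ⟨_, rfl⟩]

lemma Involutive.commutative_of_generates (hinv : X.Involutive) {x : T}
    (hx : X.Generates {x}) : X.Commutative := by
  intro a b
  obtain ⟨m, rfl⟩ := hinv.intPow_surjective hx a
  obtain ⟨n, rfl⟩ := hinv.intPow_surjective hx b
  rw [hinv.intPow_mul_intPow, hinv.intPow_mul_intPow, add_comm, intPow_sub_comm]

/-- A two-valued group generated by `x` is the antipodal coset group of any quotient of `ℤ` by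
the subgroup of exponents annihilating `x`. -/
lemma Involutive.isAntipodalCosetOf (hinv : X.Involutive) {x : T} (hx : X.Generates {x})
    {C : Type v} [CommGroup C] (q : Multiplicative ℤ →* C) (hq : Function.Surjective q)
    (hker : ∀ k : ℤ, q (Multiplicative.ofAdd k) = 1 ↔ X.intPow x k = X.e) :
    X.IsAntipodalCosetOf C := by
  have hadd (m n : ℤ) : q (.ofAdd (m + n)) = q (.ofAdd m) * q (.ofAdd n) := by
    rw [ofAdd_add, map_mul]
  have hsub (m n : ℤ) : q (.ofAdd (m - n)) = q (.ofAdd m) * (q (.ofAdd n))⁻¹ := by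
    rw [ofAdd_sub, map_div, div_eq_mul_inv]
  have hq' : Function.Surjective fun k : ℤ => q (.ofAdd k) :=
    hq.comp Multiplicative.ofAdd.surjective
  have hfib (m n : ℤ) : X.intPow x m = X.intPow x n ↔
      q (.ofAdd n) = q (.ofAdd m) ∨ q (.ofAdd n) = (q (.ofAdd m))⁻¹ := by
    rw [hinv.intPow_eq_intPow_iff, ← hker, ← hker, hadd, hsub, mul_inv_eq_one,
      mul_eq_one_iff_inv_eq, or_comm, eq_comm, eq_comm (b := q (.ofAdd n))]
  choose s hs using hq'
  have hπ (k : ℤ) : X.intPow x (s (q (.ofAdd k))) = X.intPow x k :=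
    (hfib _ _).2 (Or.inl (hs _).symm)
  have hπinv (a : C) : X.intPow x (s a⁻¹) = X.intPow x (s a) :=
    (hfib _ _).2 (Or.inr (by simp only [hs, inv_inv]))
  refine ⟨fun c => X.intPow x (s c), ?_, ?_, hπinv, ?_, ?_, ?_⟩
  · intro t
    obtain ⟨k, rfl⟩ := hinv.intPow_surjective hx t
    exact ⟨_, hπ k⟩
  · exact (hker _).1 (hs 1)
  · intro a b hab
    simpa only [hs] using (hfib _ _).1 hab
  · intro a b
    have h₁ : a * b = q (.ofAdd (s a + s b)) := by rw [hadd]; simp only [hs]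
    have h₂ : a * b⁻¹ = q (.ofAdd (s a - s b)) := by rw [hsub]; simp only [hs]
    rw [hinv.intPow_mul_intPow]
    simp only [h₁, h₂, hπ]
  · intro a
    rw [hinv]
    exact (hπinv a).symm

end Involutive

/-- **Theorem 2.1 (theorem_1gen).** Every single-generated involutive two-valued group is
isomorphic to a coset two-valued group `C/ι_a` where `C` is a cyclic group and `ι_a` is
the antipodal involution. In particular, such a two-valued group is commutative. -/
theorem singleGenerated_classification {T : Type u} (X : TwoValuedGroup T)
    (hinv : X.Involutive) (hgen : ∃ x : T, X.Generates {x}) :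
    X.Commutative ∧
    ∃ (C : Type u) (iC : CommGroup C),
      @IsCyclicGroup C iC.toGroup ∧ @IsAntipodalCosetOf T X C iC := by
  obtain ⟨x, hx⟩ := hgen
  let q : Multiplicative ℤ →* ULift.{u} (Multiplicative (ℤ ⧸ hinv.exponents x)) :=
    MulEquiv.ulift.symm.toMonoidHom.comp
      (AddMonoidHom.toMultiplicative (QuotientAddGroup.mk' (hinv.exponents x)))
  have hq : Function.Surjective q :=
    MulEquiv.ulift.symm.surjective.comp (QuotientAddGroup.mk'_surjective (hinv.exponents x))
  have hker (k : ℤ) : q (Multiplicative.ofAdd k) = 1 ↔ X.intPow x k = X.e := by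
    rw [← hinv.mem_exponents, ← QuotientAddGroup.eq_zero_iff, ← ofAdd_eq_one]
    exact EmbeddingLike.map_eq_one_iff (f := MulEquiv.ulift.symm)
  refine ⟨hinv.commutative_of_generates hx, _, inferInstance,
    ⟨q (Multiplicative.ofAdd 1), fun c => ?_⟩, hinv.isAntipodalCosetOf hx q hq hker⟩
  obtain ⟨k, rfl⟩ := hq c
  refine ⟨k.toAdd, ?_⟩
  change q (Multiplicative.ofAdd 1) ^ k.toAdd = q k
  rw [← map_zpow, ← ofAdd_zsmul, smul_eq_mul, mul_one, ofAdd_toAdd]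

end TwoValuedGroup
end

section
/- Let X be a non-special involutive commutative two-valued group containing at least one element whose order is neither 1, nor 2, nor 4. Then X is isomorphic to a coset two-valued group of the form X^a_A = A/ι_a, where A is an abelian group and ι_a(a) = a⁻¹ is the antipodal involution on A. (No finite generation assumption is needed.) -/
/-!
Two-valued groups after V.M. Buchstaber, A.P. Veselov and A.A. Gaifullin.

`X.mul x y` is the two-element multiset `x * y`.
-/

universe u v w u' v' w'

namespace TwoValuedGroup

open Classical in
/-- A commutative ring `R` in which a set `T` is embedded as linearly independent elements,
closed under the two-valued multiplication `x y = (z + w) / 2`. -/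
structure Linearization (T : Type u) (R : Type v) [CommRing R] where
  ι : T → R
  coeff : T → R →+ ℚ
  coeff_ι : ∀ p q, coeff p (ι q) = if p = q then 1 else 0
  two_cancel : ∀ a b : R, 2 * a = 2 * b → a = b
  e : T
  ι_e : ι e = 1
  exists_mul : ∀ x y, ∃ z w, 2 * ι x * ι y = ι z + ι w
  eq_of_mul : ∀ x y w, 2 * ι x * ι y = ι e + ι w → x = y
  sq : T → T
  mul_self : ∀ x, 2 * ι x * ι x = ι e + ι (sq x)
  nonspecial : ∀ x y z, 2 * ι x * ι y = ι z + ι z → sq x = e ∨ sq y = e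

namespace Linearization

variable {T : Type u} {R : Type v} [CommRing R] (M : Linearization T R)

theorem pair_eq {a b c d : T} (h : M.ι a + M.ι b = M.ι c + M.ι d) :
    (a = c ∧ b = d) ∨ (a = d ∧ b = c) := by
  have ha := congrArg (M.coeff a) h
  have hb := congrArg (M.coeff b) h
  have hc := congrArg (M.coeff c) h
  simp only [map_add, M.coeff_ι] at ha hb hc
  grind

theorem ι_injective {a b : T} (h : M.ι a = M.ι b) : a = b := by
  have := M.pair_eq (a := a) (b := a) (c := b) (d := b) (by rw [h])
  tauto

theorem mem_quad {a b c d p q r s : T}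
    (h : M.ι a + M.ι b + M.ι c + M.ι d = M.ι p + M.ι q + M.ι r + M.ι s) :
    a = p ∨ a = q ∨ a = r ∨ a = s := by
  have ha := congrArg (M.coeff a) h
  simp only [map_add, M.coeff_ι] at ha
  grind

/-- Membership in a product is reversible. -/
theorem reverse {x y p q : T} (h : 2 * M.ι x * M.ι y = M.ι p + M.ι q) :
    ∃ r, 2 * M.ι x * M.ι p = M.ι y + M.ι r := by
  obtain ⟨a, b, hab⟩ := M.exists_mul x p
  obtain ⟨g, k, hg⟩ := M.exists_mul q p
  obtain ⟨a1, a2, ha⟩ := M.exists_mul y a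
  obtain ⟨b1, b2, hb⟩ := M.exists_mul y b
  have hp := M.mul_self p
  have hm := M.mem_quad (a := M.e) (b := M.sq p) (c := g) (d := k) (p := a1) (q := a2)
    (r := b1) (s := b2) (by
      linear_combination -hp - hg + ha + hb + (-2 * M.ι p) * h + (2 * M.ι y) * hab)
  have hya : y = a ∨ y = b := by
    rcases hm with h | h | h | h <;> subst h
    · exact Or.inl (M.eq_of_mul _ _ _ ha)
    · exact Or.inl (M.eq_of_mul _ _ a1 (by rw [ha, add_comm]))
    · exact Or.inr (M.eq_of_mul _ _ _ hb)
    · exact Or.inr (M.eq_of_mul _ _ b1 (by rw [hb, add_comm]))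
  rcases hya with rfl | rfl
  · exact ⟨b, hab⟩
  · exact ⟨a, by rw [hab, add_comm]⟩

theorem reverse' {x y p q : T} (h : 2 * M.ι x * M.ι y = M.ι p + M.ι q) :
    ∃ r, 2 * M.ι p * M.ι y = M.ι x + M.ι r := by
  obtain ⟨r, hr⟩ := M.reverse (x := y) (y := x) (p := p) (q := q) (by linear_combination h)
  exact ⟨r, by linear_combination hr⟩

theorem sq_e : M.sq M.e = M.e := by
  have h := M.mul_self M.e
  apply M.ι_injective
  rw [M.ι_e] at *
  linear_combination -h

theorem ι_sq (x : T) : M.ι (M.sq x) = 2 * M.ι x * M.ι x - 1 := by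
  rw [M.mul_self, M.ι_e]; ring

theorem mul_self_eq_one {x : T} (h : M.sq x = M.e) : M.ι x * M.ι x = 1 := by
  apply M.two_cancel
  have := M.ι_sq x
  rw [h, M.ι_e] at this
  linear_combination -this

/-- Multiplication by an element of order at most two is single-valued. -/
theorem mul_of_sq_eq_e {x y p q : T} (hx : M.sq x = M.e)
    (h : 2 * M.ι x * M.ι y = M.ι p + M.ι q) : M.ι x * M.ι y = M.ι p ∧ p = q := by
  have h1 := M.mul_self_eq_one hx
  obtain ⟨r, hr⟩ := M.reverse h
  obtain ⟨r', hr'⟩ := M.reverse (x := x) (y := y) (p := q) (q := p) (by rw [h, add_comm])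
  have hsum : M.ι r + M.ι r' = M.ι y + M.ι y := by
    linear_combination -hr - hr' - (2 * M.ι x) * h + 4 * M.ι y * h1
  have hry : r = y ∧ r' = y := by rcases M.pair_eq hsum with h | h <;> tauto
  obtain ⟨rfl, rfl⟩ := hry
  have hp : M.ι x * M.ι r' = M.ι p := by
    apply M.two_cancel
    linear_combination -M.ι x * hr + 2 * M.ι p * h1
  have hq : M.ι x * M.ι r' = M.ι q := by
    apply M.two_cancel
    linear_combination -M.ι x * hr' + 2 * M.ι q * h1
  exact ⟨hp, M.ι_injective (hp.symm.trans hq)⟩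

theorem exists_mul_of_sq_eq_e {x : T} (hx : M.sq x = M.e) (y : T) :
    ∃ p, M.ι p = M.ι x * M.ι y := by
  obtain ⟨p, q, h⟩ := M.exists_mul x y
  exact ⟨p, (M.mul_of_sq_eq_e hx h).1.symm⟩

theorem mul_of_mem_of_sq_eq_e {x y p q : T} (hp : M.sq p = M.e)
    (h : 2 * M.ι x * M.ι y = M.ι p + M.ι q) : M.ι x = M.ι p * M.ι y := by
  obtain ⟨r, hr⟩ := M.reverse' h
  exact (M.mul_of_sq_eq_e hp hr).1.symm

/-- Elements with equal squares differ by an element of order at most two. -/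
theorem sq_mem_eq_e {x y p q : T} (hx : M.sq x ≠ M.e) (hxy : M.sq x = M.sq y)
    (h : 2 * M.ι x * M.ι y = M.ι p + M.ι q) : M.sq p = M.e ∨ M.sq q = M.e := by
  by_contra! hne
  obtain ⟨g, k, hg⟩ := M.exists_mul p q
  have h1 := M.ι_sq x
  have h2 := M.ι_sq y
  have h3 := M.ι_sq p
  have h4 := M.ι_sq q
  have h5 := M.ι_sq (M.sq x)
  rw [← hxy] at h2
  have key : M.ι M.e + M.ι (M.sq x) + M.ι (M.sq x) + M.ι (M.sq x) + M.ι (M.sq x)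
      + M.ι (M.sq (M.sq x)) = M.ι (M.sq p) + M.ι (M.sq q) + M.ι g + M.ι g + M.ι k + M.ι k := by
    rw [M.ι_e]
    linear_combination h5 - h3 - h4 + 2 * hg + 2 * (M.ι p + M.ι q + 2 * M.ι x * M.ι y) * h
      + (2 * M.ι (M.sq x) + 2) * h1 + 4 * M.ι x ^ 2 * h2
  have hc := congrArg (M.coeff M.e) key
  simp only [map_add, M.coeff_ι] at hc
  have hgk : g = M.e ∨ k = M.e := by grind
  have hpq : p = q := by
    rcases hgk with rfl | rfl
    · exact M.eq_of_mul _ _ _ hg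
    · exact M.eq_of_mul _ _ g (by rw [hg, add_comm])
  subst hpq
  rcases M.nonspecial _ _ _ h with h | h
  · exact hx h
  · exact hx (hxy.trans h)

theorem sq_mem_mul_factors {s t u u' p q : T} (hs : M.sq s ≠ M.e) (ht : M.sq t ≠ M.e)
    (h : 2 * M.ι s * M.ι t = M.ι u + M.ι u') (hpq : 2 * M.ι u * M.ι u' = M.ι p + M.ι q) :
    p = M.sq t ∨ q = M.sq t := by
  obtain ⟨g, hg⟩ := M.reverse h
  obtain ⟨i, j, hij⟩ := M.exists_mul t g
  have hu := M.ι_sq u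
  have htt := M.ι_sq t
  have key : M.ι (M.sq u) + M.ι p + M.ι q = M.ι (M.sq t) + M.ι i + M.ι j := by
    linear_combination hu - hpq - htt + hij - 2 * M.ι u * h + 2 * M.ι t * hg
  have hc := congrArg (M.coeff (M.sq t)) key
  simp only [map_add, M.coeff_ι] at hc
  by_contra! hne
  have hut : M.sq t = M.sq u := by grind
  obtain ⟨k, hk⟩ := M.reverse' h
  rcases M.sq_mem_eq_e (x := u) (y := t) (by rwa [← hut]) hut.symm hk with h0 | h0
  · exact hs h0
  have e1 := M.mul_of_mem_of_sq_eq_e (x := u) (y := t) h0 (by rw [hk, add_comm])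
  have e2 := M.mul_self_eq_one h0
  have e3 := M.ι_sq (M.sq t)
  have : M.ι p + M.ι q = M.ι (M.sq t) + M.ι (M.sq (M.sq t)) := by
    rw [e3, htt]
    have hs' : M.ι s = 2 * M.ι u * M.ι t - M.ι k := by linear_combination -hk
    have hu' : M.ι u' = 2 * M.ι s * M.ι t - M.ι u := by linear_combination -h
    rw [← hpq, hu', hs', e1]
    linear_combination (8 * M.ι t ^ 4 - 6 * M.ι t ^ 2) * e2
  rcases M.pair_eq this with h | h <;> tauto

/-- The norm relation for the two values of a product. -/
theorem mul_factors {s t u u' : T} (ht : M.sq t ≠ M.e)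
    (h : 2 * M.ι s * M.ι t = M.ι u + M.ι u') :
    M.ι u * M.ι u' = M.ι s ^ 2 + M.ι t ^ 2 - 1 := by
  by_cases hs : M.sq s = M.e
  · obtain ⟨h1, rfl⟩ := M.mul_of_sq_eq_e hs h
    have h2 := M.mul_self_eq_one hs
    rw [← h1]
    linear_combination (M.ι t ^ 2 - 1) * h2
  by_cases hst : M.sq s = M.sq t
  · have aux : ∀ u u', 2 * M.ι s * M.ι t = M.ι u + M.ι u' → M.sq u = M.e →
        M.ι u * M.ι u' = M.ι s ^ 2 + M.ι t ^ 2 - 1 := by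
      intro u u' h h0
      have e1 := M.mul_of_mem_of_sq_eq_e h0 h
      have e2 := M.mul_self_eq_one h0
      have hu' : M.ι u' = 2 * M.ι s * M.ι t - M.ι u := by linear_combination -h
      rw [hu', e1]
      linear_combination (M.ι t ^ 2 - 1) * e2
    rcases M.sq_mem_eq_e hs hst h with h0 | h0
    · exact aux _ _ h h0
    · rw [mul_comm]; exact aux _ _ (by rw [h, add_comm]) h0
  obtain ⟨p, q, hpq⟩ := M.exists_mul u u'
  have h1 := M.sq_mem_mul_factors hs ht h hpq
  have h2 := M.sq_mem_mul_factors ht hs (s := t) (t := s) (by linear_combination h) hpq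
  have h3 := M.ι_sq s
  have h4 := M.ι_sq t
  have h5 : M.ι p + M.ι q = M.ι (M.sq s) + M.ι (M.sq t) := by
    rcases h1 with h1 | h1 <;> rcases h2 with h2 | h2
    · exact absurd (h2.symm.trans h1) hst
    · rw [h1, h2, add_comm]
    · rw [h1, h2]
    · exact absurd (h2.symm.trans h1) hst
  apply M.two_cancel
  linear_combination hpq + h5 + h3 + h4

/-- The values of `x * s` and `y * s` can be matched when `y` is a value of `x * t`. -/
theorem matching {x s t y y' z z' w w' : T} (hy : 2 * M.ι x * M.ι t = M.ι y + M.ι y')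
    (hz : 2 * M.ι x * M.ι s = M.ι z + M.ι z') (hw : 2 * M.ι y * M.ι s = M.ι w + M.ι w') :
    ((∃ r, 2 * M.ι z * M.ι t = M.ι w + M.ι r) ∧ (∃ r, 2 * M.ι z' * M.ι t = M.ι w' + M.ι r)) ∨
    ((∃ r, 2 * M.ι z * M.ι t = M.ι w' + M.ι r) ∧ (∃ r, 2 * M.ι z' * M.ι t = M.ι w + M.ι r)) := by
  have aux : ∀ x s t y y' z z' w w', 2 * M.ι x * M.ι t = M.ι y + M.ι y' →
      2 * M.ι x * M.ι s = M.ι z + M.ι z' → 2 * M.ι y * M.ι s = M.ι w + M.ι w' →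
      (∃ r, 2 * M.ι z * M.ι t = M.ι w + M.ι r) ∨ (∃ r, 2 * M.ι z' * M.ι t = M.ι w + M.ι r) := by
    intro x s t y y' z z' w w' hy hz hw
    obtain ⟨a, b, hab⟩ := M.exists_mul z t
    obtain ⟨c, d, hcd⟩ := M.exists_mul z' t
    obtain ⟨f, g, hfg⟩ := M.exists_mul y' s
    rcases M.mem_quad (a := w) (b := w') (c := f) (d := g) (p := a) (q := b) (r := c) (s := d)
      (by linear_combination hab + hcd - hw - hfg + 2 * M.ι t * hz - 2 * M.ι s * hy)
      with rfl | rfl | rfl | rfl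
    · exact .inl ⟨_, hab⟩
    · exact .inl ⟨a, by rw [hab, add_comm]⟩
    · exact .inr ⟨_, hcd⟩
    · exact .inr ⟨c, by rw [hcd, add_comm]⟩
  have h1 := aux _ _ _ _ _ _ _ _ _ hy hz hw
  have h2 := aux _ _ _ _ _ _ _ _ _ hy hz (hw.trans (add_comm _ _))
  obtain ⟨x', hx'⟩ := M.reverse' hy
  have rev : ∀ p q, (∃ r, 2 * M.ι p * M.ι t = M.ι q + M.ι r) →
    (∃ r, 2 * M.ι q * M.ι t = M.ι p + M.ι r) := fun p q ⟨_, h⟩ => M.reverse' h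
  have h3 := (aux _ _ _ _ _ _ _ _ _ hx' hw hz).imp (rev _ _) (rev _ _)
  have h4 := (aux _ _ _ _ _ _ _ _ _ hx' hw (hz.trans (add_comm _ _))).imp (rev _ _) (rev _ _)
  rcases h1 with h1 | h1
  · rcases h2 with h2 | h2
    · exact h4.elim (fun h => .inr ⟨h2, h⟩) fun h => .inl ⟨h1, h⟩
    · exact .inl ⟨h1, h2⟩
  · rcases h2 with h2 | h2
    · exact .inr ⟨h2, h1⟩
    · exact h3.elim (fun h => .inl ⟨h, h2⟩) fun h => .inr ⟨h, h1⟩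

/-- `t² - 1` can be cancelled from basis elements. -/
theorem cancel {t z z' : T} (ht : M.sq t ≠ M.e) (ht' : M.sq (M.sq t) ≠ M.e)
    (h : (M.ι t ^ 2 - 1) * M.ι z = (M.ι t ^ 2 - 1) * M.ι z') : z = z' := by
  by_contra hne
  obtain ⟨a, b, hab⟩ := M.exists_mul (M.sq t) z
  obtain ⟨c, d, hcd⟩ := M.exists_mul (M.sq t) z'
  have h1 := M.ι_sq t
  have key : M.ι a + M.ι b + M.ι z' + M.ι z' = M.ι c + M.ι d + M.ι z + M.ι z := by
    linear_combination -hab + hcd + 4 * h + (2 * M.ι z - 2 * M.ι z') * h1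
  have hc := congrArg (M.coeff z) key
  simp only [map_add, M.coeff_ι] at hc
  have : z = a ∧ z = b := by grind
  obtain ⟨rfl, rfl⟩ := this
  rcases M.nonspecial _ _ _ hab with h | h
  · exact ht' h
  have h2 := M.mul_self_eq_one h
  apply ht
  apply M.ι_injective
  apply M.two_cancel
  rw [M.ι_e]
  linear_combination M.ι z * hab - (2 * M.ι (M.sq t) - 2) * h2

theorem mul_eq_of_mem {x y p q : T} (hpq : p ≠ q)
    (hp : ∃ r, 2 * M.ι x * M.ι y = M.ι p + M.ι r) (hq : ∃ r, 2 * M.ι x * M.ι y = M.ι q + M.ι r) :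
    2 * M.ι x * M.ι y = M.ι p + M.ι q := by
  obtain ⟨r, hr⟩ := hp
  obtain ⟨r', hr'⟩ := hq
  rcases M.pair_eq (hr.symm.trans hr') with h | h
  · exact absurd h.1 hpq
  · rw [hr, h.2]

theorem mem_of_mul_eq {x y p q a : T} (h : 2 * M.ι x * M.ι y = M.ι p + M.ι q)
    (ha : ∃ r, 2 * M.ι x * M.ι y = M.ι a + M.ι r) : a = p ∨ a = q := by
  obtain ⟨r, hr⟩ := ha
  rcases M.pair_eq (hr.symm.trans h) with h | h <;> tauto

theorem ne_of_mul {x y p q : T} (hx : M.sq x ≠ M.e) (hy : M.sq y ≠ M.e)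
    (h : 2 * M.ι x * M.ι y = M.ι p + M.ι q) : p ≠ q := by
  rintro rfl
  exact (M.nonspecial _ _ _ h).elim hx hy

theorem mul_eq_of_double_mem {s y y' w a b : T} (hs : M.sq s ≠ M.e) (hy : M.sq y ≠ M.e)
    (hy' : M.sq y' ≠ M.e) (hyy : y ≠ y')
    (h : 2 * M.ι y * M.ι s + 2 * M.ι y' * M.ι s = M.ι w + M.ι a + M.ι w + M.ι b) :
    2 * M.ι w * M.ι s = M.ι y + M.ι y' := by
  obtain ⟨c, d, hcd⟩ := M.exists_mul y s
  obtain ⟨f, g, hfg⟩ := M.exists_mul y' s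
  have h1 := M.ne_of_mul hy hs hcd
  have h2 := M.ne_of_mul hy' hs hfg
  have key : M.ι c + M.ι d + M.ι f + M.ι g = M.ι w + M.ι a + M.ι w + M.ι b := by
    linear_combination h - hcd - hfg
  have hc := congrArg (M.coeff w) key
  simp only [map_add, M.coeff_ι] at hc
  have hm : (w = c ∨ w = d) ∧ (w = f ∨ w = g) := by grind
  apply M.mul_eq_of_mem hyy
  · rcases hm.1 with rfl | rfl
    · exact M.reverse' hcd
    · exact M.reverse' (hcd.trans (add_comm _ _))
  · rcases hm.2 with rfl | rfl
    · exact M.reverse' hfg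
    · exact M.reverse' (hfg.trans (add_comm _ _))

theorem mul_eq_of_mul_one_add {τ p q : T} (hpq : p ≠ q)
    (h : M.ι p * (1 + M.ι τ) = M.ι q * (1 + M.ι τ)) : M.ι p * M.ι τ = M.ι q := by
  obtain ⟨a, b, hab⟩ := M.exists_mul p τ
  obtain ⟨c, d, hcd⟩ := M.exists_mul q τ
  have key : M.ι a + M.ι b + M.ι p + M.ι p = M.ι c + M.ι d + M.ι q + M.ι q := by
    linear_combination 2 * h - hab + hcd
  have hc := congrArg (M.coeff q) key
  simp only [map_add, M.coeff_ι] at hc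
  have : q = a ∧ q = b := by grind
  obtain ⟨rfl, rfl⟩ := this
  apply M.two_cancel
  linear_combination hab

/-- Three elements are in general position if none of them, and none of the values of their
pairwise products, has order at most two. -/
structure General (x s t y y' u u' z z' : T) : Prop where
  hx : M.sq x ≠ M.e
  hs : M.sq s ≠ M.e
  ht : M.sq t ≠ M.e
  hy : M.sq y ≠ M.e
  hy' : M.sq y' ≠ M.e
  hu : M.sq u ≠ M.e
  hu' : M.sq u' ≠ M.e
  hz : M.sq z ≠ M.e
  hz' : M.sq z' ≠ M.e
  xt : 2 * M.ι x * M.ι t = M.ι y + M.ι y'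
  st : 2 * M.ι s * M.ι t = M.ι u + M.ι u'
  xs : 2 * M.ι x * M.ι s = M.ι z + M.ι z'

variable {M}

theorem General.swap {x s t y y' u u' z z' : T} (G : M.General x s t y y' u u' z z') :
    M.General x s t y y' u u' z' z :=
  { G with hz := G.hz', hz' := G.hz, xs := G.xs.trans (add_comm _ _) }

theorem General.no_common {x s t y y' u u' z z' w a b : T} (G : M.General x s t y y' u u' z z')
    (hza : 2 * M.ι z * M.ι t = M.ι w + M.ι a) (hzb : 2 * M.ι z' * M.ι t = M.ι w + M.ι b) :
    False := by
  have hzz := M.ne_of_mul G.hx G.hs G.xs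
  have h1 : 2 * M.ι w * M.ι t = M.ι z + M.ι z' :=
    M.mul_eq_of_mem hzz (M.reverse' hza) (M.reverse' hzb)
  have h2 : 2 * M.ι w * M.ι s = M.ι y + M.ι y' :=
    M.mul_eq_of_double_mem (a := a) (b := b) G.hs G.hy G.hy' (M.ne_of_mul G.hx G.ht G.xt)
      (by linear_combination hza + hzb - 2 * M.ι s * G.xt + 2 * M.ι t * G.xs)
  have h3 : 2 * M.ι w * M.ι x = M.ι u + M.ι u' :=
    M.mul_eq_of_double_mem (a := a) (b := b) G.hx G.hu G.hu' (M.ne_of_mul G.hs G.ht G.st)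
      (by linear_combination hza + hzb - 2 * M.ι x * G.st + 2 * M.ι t * G.xs)
  have hw : M.sq w ≠ M.e := fun h => hzz (M.mul_of_sq_eq_e h h1).2
  have e1 : M.ι w * M.ι t = M.ι x * M.ι s := M.two_cancel _ _ (by linear_combination h1 - G.xs)
  have e2 : M.ι w * M.ι s = M.ι x * M.ι t := M.two_cancel _ _ (by linear_combination h2 - G.xt)
  have e3 : M.ι w * M.ι x = M.ι s * M.ι t := M.two_cancel _ _ (by linear_combination h3 - G.st)
  have n1 : M.sq w ≠ M.sq x := fun h => (M.sq_mem_eq_e hw h h3).elim G.hu G.hu'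
  have n2 : M.sq w ≠ M.sq s := fun h => (M.sq_mem_eq_e hw h h2).elim G.hy G.hy'
  have n3 : M.sq x ≠ M.sq s := fun h => (M.sq_mem_eq_e G.hx h G.xs).elim G.hz G.hz'
  have i1 := M.mul_eq_of_mul_one_add (τ := M.sq t) n1 (by
    rw [M.ι_sq, M.ι_sq, M.ι_sq]
    linear_combination 4 * M.ι w * M.ι t * e1 + 4 * M.ι x * M.ι t * e2)
  have i2 := M.mul_eq_of_mul_one_add (τ := M.sq t) n2 (by
    rw [M.ι_sq, M.ι_sq, M.ι_sq]
    linear_combination 4 * M.ι w * M.ι t * e1 + 4 * M.ι s * M.ι t * e3)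
  exact n3 (M.ι_injective (i1.symm.trans i2))

/-- The product of two orientations, given the mutual position of the values of `x * s * t`. -/
theorem General.product_of_position {x s t y y' u u' z z' a b c d : T}
    (G : M.General x s t y y' u u' z z') (ht' : M.sq (M.sq t) ≠ M.e)
    (hz : 2 * M.ι z * M.ι t = M.ι a + M.ι b) (hz' : 2 * M.ι z' * M.ι t = M.ι c + M.ι d)
    (hys : 2 * M.ι y * M.ι s = M.ι a + M.ι c) (hxu : 2 * M.ι x * M.ι u = M.ι a + M.ι d) :
    M.ι y * M.ι u - M.ι x * M.ι s = M.ι t * M.ι a - M.ι z ∧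
    2 * M.ι t * M.ι x * M.ι s - M.ι x * M.ι u - M.ι y * M.ι s = M.ι t * M.ι z - M.ι a := by
  have hst := G.st
  have hxs := G.xs
  have hxt := G.xt
  refine ⟨?_, M.two_cancel _ _ (by linear_combination 2 * M.ι t * hxs + hz' - hys - hxu)⟩
  have nac : a ≠ c := by rintro rfl; exact G.no_common hz hz'
  have nad : a ≠ d := by rintro rfl; exact G.no_common hz (hz'.trans (add_comm _ _))
  have nbc : b ≠ c := by rintro rfl; exact G.no_common (hz.trans (add_comm _ _)) hz'
  have nbd : b ≠ d := by
    rintro rfl; exact G.no_common (hz.trans (add_comm _ _)) (hz'.trans (add_comm _ _))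
  obtain ⟨z₁, h1⟩ := M.reverse' hz
  obtain ⟨z₃, h3⟩ := M.reverse' (hz.trans (add_comm _ _))
  obtain ⟨z₂, h2⟩ := M.reverse' hz'
  obtain ⟨z₄, h4⟩ := M.reverse' (hz'.trans (add_comm _ _))
  have hτ := M.ι_sq t
  have n13 : z₁ ≠ z₃ := M.ne_of_mul (x := z) (y := M.sq t) G.hz ht' (by
    linear_combination h1 + h3 + 2 * M.ι t * hz + 2 * M.ι z * hτ)
  have n24 : z₂ ≠ z₄ := M.ne_of_mul (x := z') (y := M.sq t) G.hz' ht' (by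
    linear_combination h2 + h4 + 2 * M.ι t * hz' + 2 * M.ι z' * hτ)
  have nzz := M.ne_of_mul G.hx G.hs hxs
  have mz : ∀ p, (∃ r, 2 * M.ι p * M.ι t = M.ι z + M.ι r) → p = a ∨ p = b :=
    fun p ⟨_, h⟩ => M.mem_of_mul_eq hz (M.reverse' h)
  have mz' : ∀ p, (∃ r, 2 * M.ι p * M.ι t = M.ι z' + M.ι r) → p = c ∨ p = d :=
    fun p ⟨_, h⟩ => M.mem_of_mul_eq hz' (M.reverse' h)
  have nz2 : z ≠ z₂ := by
    rintro rfl; have := mz c ⟨_, h2.trans (add_comm _ _)⟩; grind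
  have nz4 : z ≠ z₄ := by
    rintro rfl; have := mz d ⟨_, h4.trans (add_comm _ _)⟩; grind
  have nz1 : z' ≠ z₁ := by
    rintro rfl; have := mz' a ⟨_, h1.trans (add_comm _ _)⟩; grind
  obtain ⟨m, n, hmn⟩ := M.exists_mul y u
  obtain ⟨m', n', hmn'⟩ := M.exists_mul y' u
  obtain ⟨k, l, hkl⟩ := M.exists_mul y' u'
  have f1 := M.matching (x := s) (s := y) (t := t) (y := u) (z := a) (z' := c) (w := m)
    (w' := n) hst (by linear_combination hys) (by linear_combination hmn)
  have f2 := M.matching (x := x) (s := u) (t := t) (y := y) (z := a) (z' := d) (w := m)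
    (w' := n) hxt hxu hmn
  have f1' : ((m = z ∨ m = z₁) ∧ (n = z' ∨ n = z₂)) ∨ ((n = z ∨ n = z₁) ∧ (m = z' ∨ m = z₂)) :=
    f1.imp (And.imp (M.mem_of_mul_eq h1) (M.mem_of_mul_eq h2))
      (And.imp (M.mem_of_mul_eq h1) (M.mem_of_mul_eq h2))
  have f2' : ((m = z ∨ m = z₁) ∧ (n = z' ∨ n = z₄)) ∨ ((n = z ∨ n = z₁) ∧ (m = z' ∨ m = z₄)) :=
    f2.imp (And.imp (M.mem_of_mul_eq h1) (M.mem_of_mul_eq h4))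
      (And.imp (M.mem_of_mul_eq h1) (M.mem_of_mul_eq h4))
  have g1 : M.ι m + M.ι n + M.ι m' + M.ι n' = M.ι z + M.ι z₁ + M.ι z' + M.ι z₄ := by
    linear_combination -hmn - hmn' - 2 * M.ι u * hxt + 2 * M.ι t * hxu + h1 + h4
  have g2 : M.ι m' + M.ι n' + M.ι k + M.ι l = M.ι z + M.ι z₃ + M.ι z' + M.ι z₄ := by
    linear_combination -hmn' - hkl - 2 * M.ι y' * hst + h3 + h4 +
      2 * M.ι t * (hz + hz' + 2 * M.ι t * hxs - hys - 2 * M.ι s * hxt)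
  have bad : M.ι m + M.ι n = M.ι z + M.ι z' → z₁ = z := by
    intro h
    have := congrArg (M.coeff z₁) (show M.ι z₁ + M.ι k + M.ι l = M.ι z + M.ι z₃ + M.ι z' by
      linear_combination g2 - g1 + h)
    simp only [map_add, M.coeff_ι] at this
    grind
  have hcases : ((m = z ∨ m = z₁) ∧ n = z') ∨ ((n = z ∨ n = z₁) ∧ m = z') := by
    clear * - f1' f2' n24 nz2 nz4 nz1 nzz
    grind
  have goal : M.ι m + M.ι n = M.ι z' + M.ι z₁ := by
    rcases hcases with ⟨rfl | rfl, rfl⟩ | ⟨rfl | rfl, rfl⟩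
    · rw [bad rfl, add_comm]
    · rw [add_comm]
    · rw [bad (add_comm _ _)]
    · rfl
  apply M.two_cancel
  linear_combination hmn + goal - hxs - h1

theorem General.exists_product {x s t y y' u u' z z' : T}
    (G : M.General x s t y y' u u' z z') (ht' : M.sq (M.sq t) ≠ M.e) :
    ∃ z z' w w', 2 * M.ι x * M.ι s = M.ι z + M.ι z' ∧ 2 * M.ι z * M.ι t = M.ι w + M.ι w' ∧
    M.ι y * M.ι u - M.ι x * M.ι s = M.ι t * M.ι w - M.ι z ∧
    2 * M.ι t * M.ι x * M.ι s - M.ι x * M.ι u - M.ι y * M.ι s = M.ι t * M.ι z - M.ι w := by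
  have hxs := G.xs
  have hst := G.st
  have hxt := G.xt
  obtain ⟨a, b, c, d, hz, hz', hys⟩ : ∃ a b c d, 2 * M.ι z * M.ι t = M.ι a + M.ι b ∧
      2 * M.ι z' * M.ι t = M.ι c + M.ι d ∧ 2 * M.ι y * M.ι s = M.ι a + M.ι c := by
    obtain ⟨a, c, hac⟩ := M.exists_mul y s
    rcases M.matching hxt hxs hac with ⟨⟨b, hb⟩, ⟨d, hd⟩⟩ | ⟨⟨b, hb⟩, ⟨d, hd⟩⟩
    · exact ⟨_, _, _, _, hb, hd, hac⟩
    · exact ⟨_, _, _, _, hb, hd, hac.trans (add_comm _ _)⟩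
  have nac : a ≠ c := by rintro rfl; exact G.no_common hz hz'
  have nad : a ≠ d := by rintro rfl; exact G.no_common hz (hz'.trans (add_comm _ _))
  have nbc : b ≠ c := by rintro rfl; exact G.no_common (hz.trans (add_comm _ _)) hz'
  have nbd : b ≠ d := by
    rintro rfl; exact G.no_common (hz.trans (add_comm _ _)) (hz'.trans (add_comm _ _))
  have nab := M.ne_of_mul G.hz G.ht hz
  have ncd := M.ne_of_mul G.hz' G.ht hz'
  have hys' : 2 * M.ι y' * M.ι s = M.ι b + M.ι d := by
    linear_combination hz + hz' - hys - 2 * M.ι s * hxt + 2 * M.ι t * hxs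
  obtain ⟨f, g, hfg⟩ := M.exists_mul x u
  have f1 := (M.matching (x := s) (s := x) (t := t) (y := u) (z := z) (z' := z') (w := f)
    (w' := g) hst (by linear_combination hxs) (by linear_combination hfg)).imp
    (And.imp (M.mem_of_mul_eq hz) (M.mem_of_mul_eq hz'))
    (And.imp (M.mem_of_mul_eq hz) (M.mem_of_mul_eq hz'))
  have f2 := (M.matching (x := t) (s := x) (t := s) (y := u) (y' := u') (z := y) (z' := y')
    (w := f) (w' := g) (by linear_combination hst) (by linear_combination hxt)
    (by linear_combination hfg)).imp
    (And.imp (M.mem_of_mul_eq hys) (M.mem_of_mul_eq hys'))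
    (And.imp (M.mem_of_mul_eq hys) (M.mem_of_mul_eq hys'))
  have hcases : M.ι f + M.ι g = M.ι a + M.ι d ∨ M.ι f + M.ι g = M.ι c + M.ι b := by grind
  rcases hcases with h | h
  · exact ⟨z, z', a, b, hxs, hz, G.product_of_position ht' hz hz' hys (hfg.trans h)⟩
  · exact ⟨z', z, c, d, G.swap.xs, hz',
      G.swap.product_of_position ht' hz' hz (hys.trans (add_comm _ _)) (hfg.trans h)⟩

variable (M)

/-- Orientations `(x, y)` and `(s, u)` have a product `(z, w)`. -/
theorem exists_product {x s t y y' u u' : T} (ht : M.sq t ≠ M.e) (ht' : M.sq (M.sq t) ≠ M.e)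
    (hxt : 2 * M.ι x * M.ι t = M.ι y + M.ι y') (hst : 2 * M.ι s * M.ι t = M.ι u + M.ι u') :
    ∃ z z' w w', 2 * M.ι x * M.ι s = M.ι z + M.ι z' ∧ 2 * M.ι z * M.ι t = M.ι w + M.ι w' ∧
    M.ι y * M.ι u - M.ι x * M.ι s = M.ι t * M.ι w - M.ι z ∧
    2 * M.ι t * M.ι x * M.ι s - M.ι x * M.ι u - M.ι y * M.ι s = M.ι t * M.ι z - M.ι w := by
  have c1 : ∀ x s y y' u u', M.sq x = M.e → 2 * M.ι x * M.ι t = M.ι y + M.ι y' →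
      2 * M.ι s * M.ι t = M.ι u + M.ι u' →
      ∃ z z' w w', 2 * M.ι x * M.ι s = M.ι z + M.ι z' ∧ 2 * M.ι z * M.ι t = M.ι w + M.ι w' ∧
      M.ι y * M.ι u - M.ι x * M.ι s = M.ι t * M.ι w - M.ι z ∧
      2 * M.ι t * M.ι x * M.ι s - M.ι x * M.ι u - M.ι y * M.ι s = M.ι t * M.ι z - M.ι w := by
    intro x s y y' u u' hx hxt hst
    obtain ⟨z, hz⟩ := M.exists_mul_of_sq_eq_e hx s
    obtain ⟨w, hw⟩ := M.exists_mul_of_sq_eq_e hx u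
    obtain ⟨w', hw'⟩ := M.exists_mul_of_sq_eq_e hx u'
    have hy := (M.mul_of_sq_eq_e hx hxt).1
    refine ⟨z, z, w, w', ?_, ?_, ?_, ?_⟩ <;> rw [hz] <;> try rw [hw]
    · ring
    · rw [hw']; linear_combination M.ι x * hst
    · rw [← hy]; ring
    · rw [← hy]; ring
  have c2 : ∀ x s y y' u u', M.sq y = M.e → 2 * M.ι x * M.ι t = M.ι y + M.ι y' →
      2 * M.ι s * M.ι t = M.ι u + M.ι u' →
      ∃ z z' w w', 2 * M.ι x * M.ι s = M.ι z + M.ι z' ∧ 2 * M.ι z * M.ι t = M.ι w + M.ι w' ∧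
      M.ι y * M.ι u - M.ι x * M.ι s = M.ι t * M.ι w - M.ι z ∧
      2 * M.ι t * M.ι x * M.ι s - M.ι x * M.ι u - M.ι y * M.ι s = M.ι t * M.ι z - M.ι w := by
    intro x s y y' u u' hy hxt hst
    obtain ⟨r, hr⟩ := M.reverse' (hst.trans (add_comm _ _))
    obtain ⟨z, hz⟩ := M.exists_mul_of_sq_eq_e hy u'
    obtain ⟨z', hz'⟩ := M.exists_mul_of_sq_eq_e hy u
    obtain ⟨w, hw⟩ := M.exists_mul_of_sq_eq_e hy s
    obtain ⟨w', hw'⟩ := M.exists_mul_of_sq_eq_e hy r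
    have hx := M.mul_of_mem_of_sq_eq_e hy hxt
    refine ⟨z, z', w, w', ?_, ?_, ?_, ?_⟩ <;> rw [hz] <;> try rw [hw]
    · rw [hz', hx]; linear_combination M.ι y * hst
    · rw [hw']; linear_combination M.ι y * hr
    · rw [hx]; linear_combination -M.ι y * hst
    · rw [hx]; linear_combination M.ι y * M.ι t * hst
  have c3 : ∀ x s y y' u u', M.sq y' = M.e → 2 * M.ι x * M.ι t = M.ι y + M.ι y' →
      2 * M.ι s * M.ι t = M.ι u + M.ι u' →
      ∃ z z' w w', 2 * M.ι x * M.ι s = M.ι z + M.ι z' ∧ 2 * M.ι z * M.ι t = M.ι w + M.ι w' ∧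
      M.ι y * M.ι u - M.ι x * M.ι s = M.ι t * M.ι w - M.ι z ∧
      2 * M.ι t * M.ι x * M.ι s - M.ι x * M.ι u - M.ι y * M.ι s = M.ι t * M.ι z - M.ι w := by
    intro x s y y' u u' hy hxt hst
    obtain ⟨r, hr⟩ := M.reverse' hst
    obtain ⟨z, hz⟩ := M.exists_mul_of_sq_eq_e hy u
    obtain ⟨z', hz'⟩ := M.exists_mul_of_sq_eq_e hy u'
    obtain ⟨w, hw⟩ := M.exists_mul_of_sq_eq_e hy r
    obtain ⟨w', hw'⟩ := M.exists_mul_of_sq_eq_e hy s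
    have hx := M.mul_of_mem_of_sq_eq_e hy (hxt.trans (add_comm _ _))
    have hy' : M.ι y = 2 * M.ι x * M.ι t - M.ι y' := by linear_combination -hxt
    refine ⟨z, z', w, w', ?_, ?_, ?_, ?_⟩ <;> rw [hz] <;> try rw [hw]
    · rw [hz', hx]; linear_combination M.ι y' * hst
    · rw [hw']; linear_combination M.ι y' * hr
    · rw [hy', hx]; linear_combination M.ι y' * M.ι t * hr
    · rw [hy', hx]; linear_combination -M.ι y' * hr
  have comm : (∃ z z' w w', 2 * M.ι s * M.ι x = M.ι z + M.ι z' ∧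
      2 * M.ι z * M.ι t = M.ι w + M.ι w' ∧
      M.ι u * M.ι y - M.ι s * M.ι x = M.ι t * M.ι w - M.ι z ∧
      2 * M.ι t * M.ι s * M.ι x - M.ι s * M.ι y - M.ι u * M.ι x = M.ι t * M.ι z - M.ι w) →
      ∃ z z' w w', 2 * M.ι x * M.ι s = M.ι z + M.ι z' ∧ 2 * M.ι z * M.ι t = M.ι w + M.ι w' ∧
      M.ι y * M.ι u - M.ι x * M.ι s = M.ι t * M.ι w - M.ι z ∧
      2 * M.ι t * M.ι x * M.ι s - M.ι x * M.ι u - M.ι y * M.ι s = M.ι t * M.ι z - M.ι w := by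
    rintro ⟨z, z', w, w', h1, h2, h3, h4⟩
    exact ⟨z, z', w, w', by linear_combination h1, h2, by linear_combination h3,
      by linear_combination h4⟩
  obtain ⟨z, z', hxs⟩ := M.exists_mul x s
  have c4 : ∀ z z', M.sq z = M.e → 2 * M.ι x * M.ι s = M.ι z + M.ι z' →
      ∃ z z' w w', 2 * M.ι x * M.ι s = M.ι z + M.ι z' ∧ 2 * M.ι z * M.ι t = M.ι w + M.ι w' ∧
      M.ι y * M.ι u - M.ι x * M.ι s = M.ι t * M.ι w - M.ι z ∧
      2 * M.ι t * M.ι x * M.ι s - M.ι x * M.ι u - M.ι y * M.ι s = M.ι t * M.ι z - M.ι w := by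
    intro z z' hz hxs
    have hx := M.mul_of_mem_of_sq_eq_e hz hxs
    have hn := M.mul_factors ht hst
    have hu' : M.ι u' = 2 * M.ι s * M.ι t - M.ι u := by linear_combination -hst
    have hs2 := M.ι_sq s
    obtain ⟨v, hv⟩ := M.exists_mul_of_sq_eq_e hz u
    obtain ⟨v', hv'⟩ := M.exists_mul_of_sq_eq_e hz u'
    have hyv : y = v ∨ y = v' := by
      have : M.ι y + M.ι y' = M.ι v + M.ι v' := by
        rw [hv, hv', ← hxt, hx]
        linear_combination M.ι z * hst
      rcases M.pair_eq this with h | h <;> tauto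
    rcases hyv with rfl | rfl
    · obtain ⟨g, hg⟩ := M.reverse hst
      obtain ⟨g', hg'⟩ := M.reverse (hst.trans (add_comm _ _))
      obtain ⟨p, hp⟩ := M.exists_mul_of_sq_eq_e hz (M.sq s)
      obtain ⟨q, hq⟩ := M.exists_mul_of_sq_eq_e hz g
      obtain ⟨q', hq'⟩ := M.exists_mul_of_sq_eq_e hz g'
      refine ⟨p, z, q, q', ?_, ?_, ?_, ?_⟩ <;> rw [hp, hs2] <;> try rw [hq]
      · rw [hx]; ring
      · rw [hq']
        linear_combination M.ι z * hg + M.ι z * hg' + 2 * M.ι z * M.ι s * hst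
      · rw [hv, hx]; rw [hu'] at hn
        linear_combination -M.ι z * hn + M.ι z * M.ι t * hg
      · rw [hv, hx]
        linear_combination -M.ι z * hg
    · obtain ⟨w, hw⟩ := M.exists_mul_of_sq_eq_e hz t
      refine ⟨z, z', w, w, hxs, ?_, ?_, ?_⟩ <;> rw [hw]
      · ring
      · rw [hv', hx]; linear_combination M.ι z * hn
      · rw [hv', hx]; linear_combination M.ι z * M.ι s * hst
  by_cases hx : M.sq x = M.e
  · exact c1 _ _ _ _ _ _ hx hxt hst
  by_cases hs : M.sq s = M.e
  · exact comm (c1 _ _ _ _ _ _ hs hst hxt)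
  by_cases hy : M.sq y = M.e
  · exact c2 _ _ _ _ _ _ hy hxt hst
  by_cases hy' : M.sq y' = M.e
  · exact c3 _ _ _ _ _ _ hy' hxt hst
  by_cases hu : M.sq u = M.e
  · exact comm (c2 _ _ _ _ _ _ hu hst hxt)
  by_cases hu' : M.sq u' = M.e
  · exact comm (c3 _ _ _ _ _ _ hu' hst hxt)
  by_cases hz : M.sq z = M.e
  · exact c4 _ _ hz hxs
  by_cases hz' : M.sq z' = M.e
  · exact c4 _ _ hz' (hxs.trans (add_comm _ _))
  exact General.exists_product ⟨hx, hs, ht, hy, hy', hu, hu', hz, hz', hxt, hst, hxs⟩ ht'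

/-- The orientations of elements `x`: pairs `(x, y)` with `y` a value of `x * t`. -/
def Orientation (t : T) : Type u :=
  {p : T × T // ∃ w, 2 * M.ι p.1 * M.ι t = M.ι p.2 + M.ι w}

namespace Orientation

variable {M} {t : T}

/-- The element underlying an orientation. -/
def base (a : M.Orientation t) : T := a.1.1

/-- The chosen value of `base * t`. -/
def value (a : M.Orientation t) : T := a.1.2

theorem exists_mul_base (a : M.Orientation t) :
    ∃ w, 2 * M.ι a.base * M.ι t = M.ι a.value + M.ι w := a.2

@[ext]
theorem ext {a b : M.Orientation t} (h : a.base = b.base) (h' : a.value = b.value) : a = b :=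
  Subtype.ext (Prod.ext h h')

/-- The orientation `(x, y)` as an element `y - x ω` of the quadratic extension of `R` by a root
`ω` of `ω² = 2 t ω - 1`. -/
def toQuad (a : M.Orientation t) : QuadraticAlgebra R (-1) (2 * M.ι t) :=
  ⟨M.ι a.value, -M.ι a.base⟩

theorem eq_of_mul_toQuad {a b : M.Orientation t} (ht : M.sq t ≠ M.e)
    (ht' : M.sq (M.sq t) ≠ M.e)
    (h : algebraMap R (QuadraticAlgebra R (-1) (2 * M.ι t)) (M.ι t ^ 2 - 1) * a.toQuad =
      algebraMap R (QuadraticAlgebra R (-1) (2 * M.ι t)) (M.ι t ^ 2 - 1) * b.toQuad) :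
    a = b := by
  rw [← Algebra.smul_def, ← Algebra.smul_def] at h
  have hr := congrArg QuadraticAlgebra.re h
  have hi := congrArg QuadraticAlgebra.im h
  simp only [QuadraticAlgebra.re_smul, QuadraticAlgebra.im_smul, smul_eq_mul, toQuad] at hr hi
  exact ext (M.cancel ht ht' (by linear_combination -hi)) (M.cancel ht ht' hr)

instance : One (M.Orientation t) :=
  ⟨⟨(M.e, t), t, by rw [M.ι_e]; ring⟩⟩

theorem base_one : (1 : M.Orientation t).base = M.e := rfl

theorem value_one : (1 : M.Orientation t).value = t := rfl

theorem toQuad_one_mul_self : (1 : M.Orientation t).toQuad * (1 : M.Orientation t).toQuad =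
    algebraMap R (QuadraticAlgebra R (-1) (2 * M.ι t)) (M.ι t ^ 2 - 1) := by
  rw [QuadraticAlgebra.algebraMap_eq]
  ext <;> simp only [toQuad, base_one, value_one, M.ι_e, QuadraticAlgebra.re_mul,
    QuadraticAlgebra.im_mul] <;> ring

theorem eq_of_one_mul_toQuad {a b : M.Orientation t} (ht : M.sq t ≠ M.e)
    (ht' : M.sq (M.sq t) ≠ M.e)
    (h : (1 : M.Orientation t).toQuad * a.toQuad = (1 : M.Orientation t).toQuad * b.toQuad) :
    a = b :=
  eq_of_mul_toQuad ht ht' (by rw [← toQuad_one_mul_self, mul_assoc, h, mul_assoc])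

noncomputable instance : Inv (M.Orientation t) :=
  ⟨fun a => ⟨(a.base, a.exists_mul_base.choose), a.value,
    a.exists_mul_base.choose_spec.trans (add_comm _ _)⟩⟩

theorem base_inv (a : M.Orientation t) : a⁻¹.base = a.base := rfl

theorem mul_base (a : M.Orientation t) :
    2 * M.ι a.base * M.ι t = M.ι a.value + M.ι a⁻¹.value :=
  a.exists_mul_base.choose_spec

theorem eq_or_eq_inv {a b : M.Orientation t} (h : a.base = b.base) : b = a ∨ b = a⁻¹ := by
  have hb := b.mul_base
  rw [← h, a.mul_base] at hb
  rcases M.pair_eq hb with h' | h'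
  · exact .inl (ext h.symm h'.1.symm)
  · exact .inr (ext h.symm h'.2.symm)

theorem toQuad_mul_inv (ht : M.sq t ≠ M.e) (a : M.Orientation t) :
    a.toQuad * a⁻¹.toQuad =
      algebraMap R (QuadraticAlgebra R (-1) (2 * M.ι t)) (M.ι t ^ 2 - 1) := by
  have h := M.mul_factors ht a.mul_base
  have h' := a.mul_base
  rw [QuadraticAlgebra.algebraMap_eq]
  ext <;> simp only [toQuad, base_inv, QuadraticAlgebra.re_mul, QuadraticAlgebra.im_mul]
  · linear_combination h
  · linear_combination M.ι a.base * h'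

theorem toQuad_add_inv (a : M.Orientation t) :
    a.toQuad + a⁻¹.toQuad = algebraMap R (QuadraticAlgebra R (-1) (2 * M.ι t))
      (2 * M.ι a.base) * (1 : M.Orientation t).toQuad := by
  have h' := a.mul_base
  rw [← Algebra.smul_def]
  ext <;> simp only [toQuad, base_inv, base_one, value_one, M.ι_e, QuadraticAlgebra.re_add,
    QuadraticAlgebra.im_add, QuadraticAlgebra.re_smul, QuadraticAlgebra.im_smul, smul_eq_mul]
  · linear_combination -h'
  · ring

theorem exists_toQuad_mul (ht : M.sq t ≠ M.e) (ht' : M.sq (M.sq t) ≠ M.e)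
    (a b : M.Orientation t) :
    ∃ c : M.Orientation t, a.toQuad * b.toQuad = (1 : M.Orientation t).toQuad * c.toQuad ∧
      ∃ z, 2 * M.ι a.base * M.ι b.base = M.ι c.base + M.ι z := by
  obtain ⟨z, z', w, w', h1, h2, h3, h4⟩ := M.exists_product ht ht' a.mul_base b.mul_base
  refine ⟨⟨(z, w), w', h2⟩, ?_, z', h1⟩
  have hb : base (M := M) (t := t) ⟨(z, w), w', h2⟩ = z := rfl
  have hv : value (M := M) (t := t) ⟨(z, w), w', h2⟩ = w := rfl
  ext <;> simp only [toQuad, base_one, value_one, M.ι_e, QuadraticAlgebra.re_mul,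
    QuadraticAlgebra.im_mul, hb, hv]
  · linear_combination h3
  · linear_combination h4

/-- The product of orientations. -/
noncomputable def prod (ht : M.sq t ≠ M.e) (ht' : M.sq (M.sq t) ≠ M.e)
    (a b : M.Orientation t) : M.Orientation t :=
  (exists_toQuad_mul ht ht' a b).choose

theorem toQuad_prod (ht : M.sq t ≠ M.e) (ht' : M.sq (M.sq t) ≠ M.e) (a b : M.Orientation t) :
    a.toQuad * b.toQuad = (1 : M.Orientation t).toQuad * (prod ht ht' a b).toQuad :=
  (exists_toQuad_mul ht ht' a b).choose_spec.1

theorem base_prod (ht : M.sq t ≠ M.e) (ht' : M.sq (M.sq t) ≠ M.e) (a b : M.Orientation t) :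
    ∃ z, 2 * M.ι a.base * M.ι b.base = M.ι (prod ht ht' a b).base + M.ι z :=
  (exists_toQuad_mul ht ht' a b).choose_spec.2

/-- Orientations form an abelian group. -/
noncomputable abbrev commGroup (ht : M.sq t ≠ M.e) (ht' : M.sq (M.sq t) ≠ M.e) :
    CommGroup (M.Orientation t) :=
  letI : Mul (M.Orientation t) := ⟨prod ht ht'⟩
  have hm : ∀ a b : M.Orientation t,
      a.toQuad * b.toQuad = (1 : M.Orientation t).toQuad * (a * b).toQuad := toQuad_prod ht ht'
  have comm : ∀ a b : M.Orientation t, a * b = b * a := fun a b =>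
    eq_of_one_mul_toQuad ht ht' (by rw [← hm, ← hm]; ring)
  have one_mul' : ∀ a : M.Orientation t, 1 * a = a := fun a =>
    eq_of_one_mul_toQuad ht ht' (hm 1 a).symm
  { mul_assoc := fun a b c => by
      apply eq_of_mul_toQuad ht ht'
      rw [← toQuad_one_mul_self, mul_assoc, mul_assoc, ← hm, ← hm]
      linear_combination -c.toQuad * hm a b + a.toQuad * hm b c
    one_mul := one_mul'
    mul_one := fun a => (comm a 1).trans (one_mul' a)
    inv_mul_cancel := fun a => by
      apply eq_of_one_mul_toQuad ht ht'
      rw [← hm, mul_comm a⁻¹.toQuad, toQuad_mul_inv ht, toQuad_one_mul_self]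
    mul_comm := comm }

theorem mul_base_base (ht : M.sq t ≠ M.e) (ht' : M.sq (M.sq t) ≠ M.e)
    (a b : M.Orientation t) : 2 * M.ι a.base * M.ι b.base =
      M.ι (prod ht ht' a b).base + M.ι (prod ht ht' a b⁻¹).base := by
  obtain ⟨z, hz⟩ := base_prod ht ht' a b
  have key : algebraMap R (QuadraticAlgebra R (-1) (2 * M.ι t)) (M.ι t ^ 2 - 1) *
      ((prod ht ht' a b).toQuad + (prod ht ht' a b⁻¹).toQuad) =
      algebraMap R (QuadraticAlgebra R (-1) (2 * M.ι t)) (M.ι t ^ 2 - 1) *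
      (algebraMap R (QuadraticAlgebra R (-1) (2 * M.ι t)) (2 * M.ι b.base) * a.toQuad) := by
    rw [← toQuad_one_mul_self]
    linear_combination (1 : M.Orientation t).toQuad * (a.toQuad * toQuad_add_inv b
      - toQuad_prod ht ht' a b - toQuad_prod ht ht' a b⁻¹)
  rw [← Algebra.smul_def, ← Algebra.smul_def, ← Algebra.smul_def] at key
  have hi := congrArg QuadraticAlgebra.im key
  simp only [QuadraticAlgebra.im_smul, QuadraticAlgebra.im_add, smul_eq_mul, toQuad] at hi
  have : z = (prod ht ht' a b⁻¹).base :=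
    M.cancel ht ht' (by linear_combination hi - (M.ι t ^ 2 - 1) * hz)
  rw [hz, this]

end Orientation

end Linearization

variable {T : Type u}

/-- The formal sum of the elements of a multiset. -/
noncomputable def formalSum (s : Multiset T) : T →₀ ℚ :=
  (s.map fun z => Finsupp.single z 1).sum

theorem formalSum_pair (z w : T) :
    formalSum {z, w} = Finsupp.single z 1 + Finsupp.single w 1 := by
  simp [formalSum]

theorem formalSum_bind {S : Type v} (s : Multiset S) (f : S → Multiset T) :
    formalSum (s.bind f) = (s.map fun t => formalSum (f t)).sum := by
  simp [formalSum, Multiset.map_bind, Multiset.sum_bind]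

open Classical in
theorem formalSum_apply (s : Multiset T) (p : T) : formalSum s p = s.count p := by
  induction s using Multiset.induction with
  | empty => simp [formalSum]
  | cons a s ih =>
    have h : formalSum (a ::ₘ s) = Finsupp.single a 1 + formalSum s := by simp [formalSum]
    rw [h, Finsupp.add_apply, ih, Multiset.count_cons, Finsupp.single_apply]
    by_cases h : a = p
    · subst h; simp [add_comm]
    · simp [h, Ne.symm h]

theorem formalSum_injective : Function.Injective (formalSum (T := T)) := by
  classical
  intro s s' h
  ext p
  have := DFunLike.congr_fun h p
  rw [formalSum_apply, formalSum_apply] at this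
  exact_mod_cast this

variable (X : TwoValuedGroup T)

/-- The averaged left translation by `x` on formal linear combinations of elements. -/
noncomputable def translation (x : T) : Module.End ℚ (T →₀ ℚ) :=
  Finsupp.linearCombination ℚ fun y => (1 / 2 : ℚ) • formalSum (X.mul x y)

theorem translation_single (x y : T) :
    X.translation x (Finsupp.single y 1) = (1 / 2 : ℚ) • formalSum (X.mul x y) := by
  simp [translation]

theorem translation_single_e (x : T) :
    X.translation x (Finsupp.single X.e 1) = Finsupp.single x 1 := by
  rw [translation_single, X.mul_e, formalSum_pair, ← two_smul ℚ, smul_smul]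
  norm_num

theorem translation_formalSum (x : T) (s : Multiset T) :
    X.translation x (formalSum s) = (1 / 2 : ℚ) • formalSum (s.bind (X.mul x)) := by
  rw [formalSum_bind, formalSum, map_multiset_sum, Multiset.map_map, Multiset.smul_sum,
    Multiset.map_map]
  simp only [Function.comp_def, translation_single]

theorem translation_e : X.translation X.e = 1 := by
  ext1 y
  ext1
  simp only [LinearMap.comp_apply, Finsupp.lsingle_apply, translation_single, X.e_mul,
    formalSum_pair, Module.End.one_apply]
  rw [← two_smul ℚ, smul_smul]
  norm_num

theorem translation_mul_translation {x y z w : T} (h : X.mul x y = {z, w}) :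
    X.translation x * X.translation y =
      (1 / 2 : ℚ) • (X.translation z + X.translation w) := by
  ext1 v
  ext1
  have hv := X.assoc x y v
  rw [h] at hv
  simp only [LinearMap.comp_apply, Finsupp.lsingle_apply, Module.End.mul_apply,
    translation_single, map_smul, translation_formalSum, LinearMap.smul_apply,
    LinearMap.add_apply, ← smul_add]
  rw [← hv, formalSum_bind]
  simp

theorem exists_mul_eq (x y : T) : ∃ z w, X.mul x y = {z, w} :=
  Multiset.card_eq_two.1 (X.card_mul x y)

variable {X}

theorem translation_commute (hc : X.Commutative) (x y : T) :
    X.translation x * X.translation y = X.translation y * X.translation x := by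
  obtain ⟨z, w, h⟩ := X.exists_mul_eq x y
  rw [X.translation_mul_translation h, X.translation_mul_translation ((hc y x).trans h)]

variable {P : T → ℤ → T}

theorem mul_self_eq (hP : X.IsPowFamily P) (x : T) : X.mul x x = {X.e, P x 2} := by
  obtain ⟨h0, h1, -, h⟩ := hP x
  simpa [h0, h1] using h 1 le_rfl

theorem pow_ordOf {x : T} (h : X.ordOf P x ≠ 0) : P x (X.ordOf P x) = X.e := by
  have hne : {n : ℕ | 0 < n ∧ P x (n : ℤ) = X.e}.Nonempty := by
    by_contra hne
    exact h (by rw [ordOf, Set.not_nonempty_iff_eq_empty.1 hne, Nat.sInf_empty])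
  exact (Nat.sInf_mem hne).2

theorem pow_two_e (hP : X.IsPowFamily P) : P X.e 2 = X.e := by
  have h := mul_self_eq hP X.e
  rw [X.e_mul] at h
  have : P X.e 2 ∈ ({X.e, X.e} : Multiset T) := by rw [h]; simp
  simpa using this

theorem ordGT2_of_pow_two_ne (hP : X.IsPowFamily P) {x : T} (hx : P x 2 ≠ X.e) :
    X.OrdGT2 P x := by
  by_contra h
  simp only [OrdGT2, not_or, not_lt] at h
  have hpow := pow_ordOf h.1
  have : X.ordOf P x = 1 ∨ X.ordOf P x = 2 := by omega
  rcases this with h' | h'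
  · rw [h', Nat.cast_one, (hP x).2.1] at hpow
    rw [hpow] at hx
    exact hx (pow_two_e hP)
  · rw [h'] at hpow
    exact hx hpow

/-- A non-special involutive commutative two-valued group is linearized by the commutative algebra
generated by its averaged translations. -/
theorem exists_linearization (hc : X.Commutative) (hinv : X.Involutive) (hP : X.IsPowFamily P)
    (hns : ¬ X.IsSpecial P) :
    ∃ (R : Type u) (_ : CommRing R) (M : Linearization T R), M.e = X.e ∧
      (∀ x, M.sq x = P x 2) ∧
      ∀ x y z w, X.mul x y = {z, w} ↔ 2 * M.ι x * M.ι y = M.ι z + M.ι w := by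
  have hcomm : ∀ a ∈ Set.range X.translation, ∀ b ∈ Set.range X.translation,
      a * b = b * a := by
    rintro _ ⟨x, rfl⟩ _ ⟨y, rfl⟩
    exact translation_commute hc x y
  let A := Algebra.adjoin ℚ (Set.range X.translation)
  have : IsMulCommutative A := Algebra.isMulCommutative_adjoin ℚ hcomm
  let _ : CommRing A :=
    { (inferInstance : Ring A) with mul_comm := IsMulCommutative.is_comm.comm }
  let ι : T → A := fun x => ⟨X.translation x, Algebra.subset_adjoin ⟨x, rfl⟩⟩
  have hmul : ∀ x y z w, X.mul x y = {z, w} ↔ 2 * ι x * ι y = ι z + ι w := by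
    intro x y z w
    have h2 : 2 * ι x * ι y = ι x * ι y + ι x * ι y := by ring
    rw [h2]
    constructor
    · intro h
      apply Subtype.ext
      change X.translation x * X.translation y + X.translation x * X.translation y =
        X.translation z + X.translation w
      rw [X.translation_mul_translation h, ← two_smul ℚ, smul_smul]
      norm_num
    · intro h
      have h := congrArg Subtype.val h
      change X.translation x * X.translation y + X.translation x * X.translation y =
        X.translation z + X.translation w at h
      have h := LinearMap.congr_fun h (Finsupp.single X.e 1)
      rw [← two_smul ℚ] at h
      simp only [LinearMap.smul_apply, LinearMap.add_apply, Module.End.mul_apply,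
        translation_single_e] at h
      apply formalSum_injective
      rw [formalSum_pair, ← h, translation_single, smul_smul]
      norm_num
  let M : Linearization T A :=
    { ι := ι
      coeff := fun p =>
        { toFun := fun a => a.1 (Finsupp.single X.e 1) p
          map_zero' := rfl
          map_add' := fun _ _ => rfl }
      coeff_ι := fun p q => by
        change X.translation q (Finsupp.single X.e 1) p = _
        classical
        rw [translation_single_e, Finsupp.single_apply]
        simp only [eq_comm]
      two_cancel := fun a b h => by
        rw [two_mul, two_mul] at h
        have h := congrArg Subtype.val h
        change a.1 + a.1 = b.1 + b.1 at h
        rw [← two_smul ℚ, ← two_smul ℚ] at h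
        exact Subtype.ext (smul_right_injective _ (two_ne_zero' ℚ) h)
      e := X.e
      ι_e := Subtype.ext X.translation_e
      exists_mul := fun x y => by
        obtain ⟨z, w, h⟩ := X.exists_mul_eq x y
        exact ⟨z, w, (hmul x y z w).1 h⟩
      eq_of_mul := fun x y w h => by
        have h := (hmul x y X.e w).2 h
        rw [X.inv_unique x y (.inl (by rw [h]; simp)), hinv]
      sq := fun x => P x 2
      mul_self := fun x => (hmul _ _ _ _).1 (mul_self_eq hP x)
      nonspecial := fun x y z h => by
        by_contra! hne
        exact hns ⟨x, y, z, ordGT2_of_pow_two_ne hP hne.1, ordGT2_of_pow_two_ne hP hne.2,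
          (hmul _ _ _ _).2 h⟩ }
  exact ⟨A, inferInstance, M, rfl, fun _ => rfl, hmul⟩

theorem ordOf_le {x : T} {n : ℕ} (hn : 0 < n) (h : P x n = X.e) :
    X.ordOf P x ≤ n ∧ X.ordOf P x ≠ 0 := by
  have hmem : n ∈ {n : ℕ | 0 < n ∧ P x (n : ℤ) = X.e} := ⟨hn, h⟩
  exact ⟨Nat.sInf_le hmem, (Nat.sInf_mem ⟨n, hmem⟩).1.ne'⟩

theorem eq_e_of_pow_three (hP : X.IsPowFamily P) {x : T} (h3 : P x 3 = X.e)
    (h4 : P x 4 = X.e) : x = X.e := by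
  have h := (hP x).2.2.2 3 (by norm_num)
  norm_num at h
  rw [h3, h4, X.mul_e] at h
  have : X.e ∈ ({x, x} : Multiset T) := by rw [h]; simp
  simpa [eq_comm] using this

/-- **Theorem 8.1 (theorem_nonspecial_classify).** A non-special involutive commutative
two-valued group containing an element whose order is neither `1`, `2` nor `4` is
isomorphic to a coset two-valued group `X^a_A = A/ι_a` for an abelian group `A` with the
antipodal involution `ι_a (a) = a⁻¹`. (No finite generation is assumed; `ordOf = 0`
encodes infinite order.) -/
theorem nonspecial_classification {T : Type u} (X : TwoValuedGroup T)
    (hc : X.Commutative) (hinv : X.Involutive)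
    (P : T → ℤ → T) (hP : X.IsPowFamily P)
    (hns : ¬ X.IsSpecial P)
    (ht : ∃ t : T, X.ordOf P t ≠ 1 ∧ X.ordOf P t ≠ 2 ∧ X.ordOf P t ≠ 4) :
    ∃ (A : Type u) (iA : CommGroup A), @IsAntipodalCosetOf T X A iA := by
  obtain ⟨R, _, M, he, hsq, hmul⟩ := exists_linearization hc hinv hP hns
  obtain ⟨t, h1, h2, h4⟩ := ht
  have hP4 : P t 4 = M.sq (M.sq t) := by
    have e3 := (hmul _ _ _ _).1 ((hP t).2.2.2 2 (by norm_num))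
    have e4 := (hmul _ _ _ _).1 ((hP t).2.2.2 3 (by norm_num))
    norm_num at e3 e4
    rw [(hP t).2.1] at e3
    apply M.ι_injective
    have h := M.ι_sq t
    rw [hsq] at h
    rw [M.ι_sq, hsq]
    linear_combination -e4 - 2 * M.ι t * e3 - (2 * M.ι (P t 2) - 1) * h
  have htwo : M.sq t ≠ M.e := by
    intro h
    rw [hsq, he] at h
    have := ordOf_le (n := 2) two_pos h
    omega
  have hfour : M.sq (M.sq t) ≠ M.e := by
    intro h
    rw [← hP4, he] at h
    have hle := ordOf_le (n := 4) four_pos h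
    have h3 : X.ordOf P t = 3 := by omega
    have h3' := pow_ordOf hle.2
    rw [h3] at h3'
    apply htwo
    rw [eq_e_of_pow_three hP h3' h, ← he, M.sq_e]
  let _ := Linearization.Orientation.commGroup htwo hfour
  refine ⟨M.Orientation t, inferInstance, Linearization.Orientation.base, fun x => ?_, he,
    fun _ => rfl, fun a b => Linearization.Orientation.eq_or_eq_inv, fun a b => ?_,
    fun a => hinv _⟩
  · obtain ⟨y, w, h⟩ := M.exists_mul x t
    exact ⟨⟨(x, y), w, h⟩, rfl⟩
  · exact (hmul _ _ _ _).2 (Linearization.Orientation.mul_base_base htwo hfour a b)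

end TwoValuedGroup
end
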